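/- Let h = c + d with 1 ≤ d ≤ c, and let π be the h-cycle i ↦ i + 1 (mod h) on {1,…,h}. With ε_{i,j} = 1 if i ≤ d < j, ε_{i,j} = −1 if j ≤ d < i, and 0 otherwise, and with a_n(O) the number of free linear segments of level n in the cyclic sign sequence of an orbit O of (π, π) on {1,…,h}², define γ(m) = ∑_O ∑_{n=1}^m a_n(O). Then γ(m) = m(h − m) for 1 ≤ m ≤ d, and γ(m) = cd for m > d. -/

import Mathlib

/-- The sign sequence on `J² = {1,…,h}²` (with `0`-based indices): `ε(i,j) = 1` if
`i ≤ d < j`, `ε(i,j) = -1` if `j ≤ d < i`, and `ε(i,j) = 0` otherwise. -/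
def signOf (h d : ℕ) (x : Fin h × Fin h) : ℤ :=
  if x.1.val < d ∧ d ≤ x.2.val then 1
  else if x.2.val < d ∧ d ≤ x.1.val then -1
  else 0

/-- `x` is the starting point of a free linear segment of level `n` in the cyclic sign
sequence of the orbit of `x` under the permutation `σ`: reading off the values
`ε x, ε (σ x), ε (σ² x), …` along the orbit (whose length is the minimal period of `x`),
there is an index `t` within the period with `ε x = -1`, `ε (σ^t x) = 1`, total sum `0`
over `[0, t]`, all proper initial partial sums in `[-n, 0)`, and some initial partial
sum equal to `-n`. -/
def StartsSegment {α : Type*} (σ : Equiv.Perm α) (ε : α → ℤ) (n : ℕ) (x : α) : Prop :=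
  ε x = -1 ∧
  ∃ t : ℕ, 0 < t ∧ t < Function.minimalPeriod (⇑σ) x ∧ ε ((σ ^ t) x) = 1 ∧
    (∑ i ∈ Finset.range (t + 1), ε ((σ ^ i) x)) = 0 ∧
    (∀ j : ℕ, j < t →
      -(n : ℤ) ≤ (∑ i ∈ Finset.range (j + 1), ε ((σ ^ i) x)) ∧
        (∑ i ∈ Finset.range (j + 1), ε ((σ ^ i) x)) < 0) ∧
    (∃ j₀ : ℕ, j₀ < t ∧ (∑ i ∈ Finset.range (j₀ + 1), ε ((σ ^ i) x)) = -(n : ℤ))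

/-- `γ(m) = ∑_O ∑_{n=1}^m a_n(O)`: summing over the orbits `O` of `σ` the number
`a_n(O)` of free linear segments of level `n` of the associated cyclic sign sequence.
Since distinct free linear segments of a cyclic sequence have distinct starting
indices, `∑_O a_n(O)` equals the number of points that start a level-`n` free linear
segment in their orbit. -/
noncomputable def gammaSeq {α : Type*} (σ : Equiv.Perm α) (ε : α → ℤ) (m : ℕ) : ℕ :=
  ∑ n ∈ Finset.Icc 1 m, Nat.card {x : α // StartsSegment σ ε n x}


lemma pow_val (h : ℕ) (π : Equiv.Perm (Fin h))
    (hπ : ∀ i : Fin h, (π i).val = (i.val + 1) % h) (x : Fin h × Fin h) (s : ℕ) :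
    (((Equiv.prodCongr π π) ^ s) x).1.val = (x.1.val + s) % h ∧
    (((Equiv.prodCongr π π) ^ s) x).2.val = (x.2.val + s) % h := by
  induction s with
  | zero => simp [Nat.mod_eq_of_lt]
  | succ s ih =>
    rw [pow_succ', Equiv.Perm.mul_apply]
    simp only [Equiv.prodCongr_apply, Prod.map_fst, Prod.map_snd, hπ]
    simp only [ih.1, ih.2]
    constructor <;> simp [Nat.mod_add_mod, add_assoc]

lemma le_minPeriod (h : ℕ) (π : Equiv.Perm (Fin h))
    (hπ : ∀ i : Fin h, (π i).val = (i.val + 1) % h) (x : Fin h × Fin h) :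
    h ≤ Function.minimalPeriod (⇑(Equiv.prodCongr π π)) x := by
  have hx := x.2.isLt
  have hper : Function.IsPeriodicPt (⇑(Equiv.prodCongr π π)) h x := by
    unfold Function.IsPeriodicPt Function.IsFixedPt
    rw [Equiv.Perm.iterate_eq_pow]
    obtain ⟨h1, h2⟩ := pow_val h π hπ x h
    apply Prod.ext <;> apply Fin.ext
    · rw [h1]; simp [Nat.mod_eq_of_lt]
    · rw [h2]; simp [Nat.mod_eq_of_lt]
  have hpos := hper.minimalPeriod_pos (by omega)
  have hfix := Function.iterate_minimalPeriod (f := ⇑(Equiv.prodCongr π π)) (x := x)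
  generalize Function.minimalPeriod (⇑(Equiv.prodCongr π π)) x = p at *
  rw [Equiv.Perm.iterate_eq_pow] at hfix
  have h2 := (pow_val h π hπ x p).2
  rw [hfix] at h2
  by_contra hlt
  push Not at hlt
  by_cases hc : x.2.val + p < h
  · rw [Nat.mod_eq_of_lt hc] at h2; omega
  · rw [Nat.mod_eq_sub_mod (by omega), Nat.mod_eq_of_lt (by omega)] at h2; omega

lemma sign_val (c d : ℕ) (π : Equiv.Perm (Fin (c + d)))
    (hπ : ∀ i : Fin (c + d), (π i).val = (i.val + 1) % (c + d))
    (x : Fin (c + d) × Fin (c + d)) (h1 : d ≤ x.1.val) (h2 : x.2.val < d)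
    (s : ℕ) (hs : s < (c + d - x.1.val) + (d - x.2.val)) :
    signOf (c + d) d (((Equiv.prodCongr π π) ^ s) x) =
      (if c + d - x.1.val ≤ s then 1 else 0) - (if s < d - x.2.val then 1 else 0) := by
  have hx := x.1.isLt
  obtain ⟨e1, e2⟩ := pow_val _ π hπ x s
  rw [Nat.mod_eq_of_lt (by omega : x.2.val + s < c + d)] at e2
  unfold signOf
  rw [e1, e2]
  by_cases hc : x.1.val + s < c + d
  · rw [Nat.mod_eq_of_lt hc]
    split_ifs <;> omega
  · rw [Nat.mod_eq_sub_mod (by omega), Nat.mod_eq_of_lt (by omega)]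
    split_ifs <;> omega

lemma sum_val (c d : ℕ) (π : Equiv.Perm (Fin (c + d)))
    (hπ : ∀ i : Fin (c + d), (π i).val = (i.val + 1) % (c + d))
    (x : Fin (c + d) × Fin (c + d)) (h1 : d ≤ x.1.val) (h2 : x.2.val < d)
    (k : ℕ) (hk : k ≤ (c + d - x.1.val) + (d - x.2.val)) :
    ∑ s ∈ Finset.range k, signOf (c + d) d (((Equiv.prodCongr π π) ^ s) x) =
      ((k - (c + d - x.1.val) : ℕ) : ℤ) - ((min k (d - x.2.val) : ℕ) : ℤ) := by
  induction k with
  | zero => simp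
  | succ k ih =>
    rw [Finset.sum_range_succ, ih (by omega), sign_val c d π hπ x h1 h2 k (by omega)]
    split_ifs <;> omega

lemma starts_iff (c d : ℕ) (π : Equiv.Perm (Fin (c + d)))
    (hπ : ∀ i : Fin (c + d), (π i).val = (i.val + 1) % (c + d))
    (x : Fin (c + d) × Fin (c + d)) (n : ℕ) :
    StartsSegment (Equiv.prodCongr π π) (signOf (c + d) d) n x ↔
      d ≤ x.1.val ∧ x.2.val < d ∧ min (c + d - x.1.val) (d - x.2.val) = n := by
  have hx := x.1.isLt
  have hp := le_minPeriod _ π hπ x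
  unfold StartsSegment
  constructor
  · rintro ⟨h0, t, ht0, -, -, hz, hall, j₀, hj, hj0⟩
    have h12 : d ≤ x.1.val ∧ x.2.val < d := by
      unfold signOf at h0
      split_ifs at h0 <;> omega
    obtain ⟨h1, h2⟩ := h12
    refine ⟨h1, h2, ?_⟩
    have hS := sum_val c d π hπ x h1 h2
    have ht : t + 1 ≤ (c + d - x.1.val) + (d - x.2.val) := by
      by_contra hcon
      have := (hall ((c + d - x.1.val) + (d - x.2.val) - 1) (by omega)).2
      rw [hS _ (by omega)] at this
      omega
    rw [hS _ ht] at hz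
    rw [hS _ (by omega)] at hj0
    have := (hall (min (c + d - x.1.val) (d - x.2.val) - 1) (by omega)).1
    rw [hS _ (by omega)] at this
    omega
  · rintro ⟨h1, h2, hn⟩
    have hS := sum_val c d π hπ x h1 h2
    refine ⟨?_, (c + d - x.1.val) + (d - x.2.val) - 1, by omega, by omega, ?_, ?_, ?_,
      n - 1, by omega, ?_⟩
    · unfold signOf
      split_ifs <;> omega
    · rw [sign_val c d π hπ x h1 h2 _ (by omega)]
      split_ifs <;> omega
    · rw [hS _ (by omega)]; omega
    · intro j hj
      rw [hS _ (by omega)]; omega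
    · rw [hS _ (by omega)]; omega

lemma card_starts (c d : ℕ) (π : Equiv.Perm (Fin (c + d)))
    (hπ : ∀ i : Fin (c + d), (π i).val = (i.val + 1) % (c + d)) (n : ℕ) :
    Nat.card {x // StartsSegment (Equiv.prodCongr π π) (signOf (c + d) d) n x} =
      ((Finset.Icc 1 c ×ˢ Finset.Icc 1 d).filter (fun p => min p.1 p.2 = n)).card := by
  classical
  rw [Nat.card_eq_fintype_card, Fintype.card_subtype]
  refine Finset.card_bij (fun x _ => (c + d - x.1.val, d - x.2.val)) ?_ ?_ ?_
  · intro x hx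
    have := x.1.isLt
    simp only [Finset.mem_filter, Finset.mem_univ, true_and, starts_iff c d π hπ] at hx
    simp only [Finset.mem_filter, Finset.mem_product, Finset.mem_Icc]
    omega
  · intro x hx y hy hxy
    have := x.1.isLt
    have := y.1.isLt
    simp only [Finset.mem_filter, Finset.mem_univ, true_and, starts_iff c d π hπ] at hx hy
    simp only [Prod.mk.injEq] at hxy
    apply Prod.ext <;> apply Fin.ext <;> omega
  · rintro ⟨a, b⟩ hp
    simp only [Finset.mem_filter, Finset.mem_product, Finset.mem_Icc] at hp
    refine ⟨(⟨c + d - a, by omega⟩, ⟨d - b, by omega⟩), ?_, ?_⟩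
    · simp only [Finset.mem_filter, Finset.mem_univ, true_and, starts_iff c d π hπ]
      omega
    · simp only [Prod.mk.injEq]
      omega

lemma gamma_add (c d : ℕ) (π : Equiv.Perm (Fin (c + d)))
    (hπ : ∀ i : Fin (c + d), (π i).val = (i.val + 1) % (c + d)) (m : ℕ) :
    gammaSeq (Equiv.prodCongr π π) (signOf (c + d) d) m + (c - m) * (d - m) = c * d := by
  unfold gammaSeq
  simp only [card_starts c d π hπ]
  have e1 : ∑ n ∈ Finset.Icc 1 m,
      ((Finset.Icc 1 c ×ˢ Finset.Icc 1 d).filter (fun p => min p.1 p.2 = n)).card =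
      ((Finset.Icc 1 c ×ˢ Finset.Icc 1 d).filter (fun p => min p.1 p.2 ≤ m)).card := by
    rw [Finset.card_eq_sum_card_fiberwise (f := fun p : ℕ × ℕ => min p.1 p.2)
      (t := Finset.Icc 1 m)]
    · apply Finset.sum_congr rfl
      intro n hn
      congr 1
      ext p
      simp only [Finset.mem_filter, Finset.mem_product, Finset.mem_Icc] at *
      omega
    · intro p hp
      simp only [Finset.coe_filter, Set.mem_setOf_eq, Finset.mem_product, Finset.mem_Icc,
        Finset.coe_Icc, Set.mem_Icc] at *
      omega
  have e2 : (c - m) * (d - m) =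
      ((Finset.Icc 1 c ×ˢ Finset.Icc 1 d).filter (fun p => ¬ min p.1 p.2 ≤ m)).card := by
    have : (Finset.Icc 1 c ×ˢ Finset.Icc 1 d).filter (fun p => ¬ min p.1 p.2 ≤ m) =
        Finset.Ioc m c ×ˢ Finset.Ioc m d := by
      ext p
      simp only [Finset.mem_filter, Finset.mem_product, Finset.mem_Icc, Finset.mem_Ioc]
      omega
    rw [this, Finset.card_product]
    simp
  rw [e1, e2, Finset.card_filter_add_card_filter_not, Finset.card_product]
  simp

/-- Let `h = c + d` with `1 ≤ d ≤ c` and let `π` be the `h`-cycle `i ↦ i + 1 (mod h)`.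
With `γ(m) = ∑_O ∑_{n=1}^m a_n(O)` as above (orbits of `(π, π)` on `{1,…,h}²`,
free linear segments of the cyclic sign sequences), one has `γ(m) = m(h - m)` for
`1 ≤ m ≤ d` and `γ(m) = cd` for `m > d`. -/
theorem gammaSeq_cycle_formula (c d : ℕ) (hd : 1 ≤ d) (hdc : d ≤ c)
    (π : Equiv.Perm (Fin (c + d)))
    (hπ : ∀ i : Fin (c + d), (π i).val = (i.val + 1) % (c + d)) :
    (∀ m : ℕ, 1 ≤ m → m ≤ d →
      gammaSeq (Equiv.prodCongr π π) (signOf (c + d) d) m = m * (c + d - m)) ∧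
    (∀ m : ℕ, d < m →
      gammaSeq (Equiv.prodCongr π π) (signOf (c + d) d) m = c * d) := by
  constructor
  · intro m _ hm
    have h := gamma_add c d π hπ m
    obtain ⟨e, rfl⟩ := Nat.exists_eq_add_of_le hm
    obtain ⟨f, rfl⟩ := Nat.exists_eq_add_of_le (hm.trans hdc)
    rw [Nat.add_sub_cancel_left, Nat.add_sub_cancel_left] at h
    rw [show m + f + (m + e) - m = m + e + f by omega]
    nlinarith
  · intro m hm
    have h := gamma_add c d π hπ m
    rwa [Nat.sub_eq_zero_of_le hm.le, Nat.mul_zero, Nat.add_zero] at h
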